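/- Let p be a prime, n an even positive integer, and s a positive integer with s ≤ n/2, where p is odd or s ≥ 2. Fix ε ∈ {1,−1}, with ε = 1 if p = 2, and let F : V_n → V_s. Then the following are equivalent. (1) F is a vectorial dual-bent function satisfying Condition A with sign ε. (2) For every nonempty subset I ⊆ V_s, the set D_{F,I} = F⁻¹(I) satisfies −D_{F,I} = D_{F,I}, and D_{F,I} \ {0} is a (p^n, k, λ, μ) partial difference set in the additive group V_n, where if F(0) ∈ I then (k, λ, μ) is parameter set (35) for |I| and ε, and if F(0) ∉ I then (k, λ, μ) is parameter set (36) for |I| and ε. -/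

import Mathlib

open Finset

/-- `ζ_p^t = exp(2πi·t.val/p)` for `t : ZMod p`. -/
noncomputable def zetaP (p : ℕ) (t : ZMod p) : ℂ :=
  Complex.exp (2 * Real.pi * Complex.I * (t.val : ℂ) / (p : ℂ))

/-- The standard inner product on `V_n = Fin n → ZMod p`. -/
def ip {p n : ℕ} (a x : Fin n → ZMod p) : ZMod p := ∑ i, a i * x i

/-- The Walsh transform of `f : V_n → ZMod p`. -/
noncomputable def walsh {p n : ℕ} [NeZero p] (f : (Fin n → ZMod p) → ZMod p)
    (a : Fin n → ZMod p) : ℂ :=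
  ∑ x : Fin n → ZMod p, zetaP p (f x - ip a x)

/-- `F : V_n → V_s` is a vectorial dual-bent function satisfying Condition A with sign `ε`. -/
def ConditionA {n s : ℕ} (p : ℕ) [NeZero p]
    (F : (Fin n → ZMod p) → (Fin s → ZMod p)) (ε : ℤ) : Prop :=
  ∃ Fd : (Fin n → ZMod p) → (Fin s → ZMod p),
    ∀ c : Fin s → ZMod p, c ≠ 0 → ∀ a : Fin n → ZMod p,
      walsh (fun x => ip c (F x)) a = (ε : ℂ) * (p : ℂ) ^ (n / 2) * zetaP p (ip c (Fd a))

/-- `D` is a `(v, k, λ, μ)` partial difference set (with `klm = (k, λ, μ)`) in the finite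
abelian group `G`. -/
def IsPDS {G : Type*} [AddCommGroup G] [Fintype G] [DecidableEq G]
    (D : Finset G) (v : ℤ) (klm : ℤ × ℤ × ℤ) : Prop :=
  (Fintype.card G : ℤ) = v ∧ (D.card : ℤ) = klm.1 ∧
  (∀ g ∈ D, g ≠ 0 →
    ((((D ×ˢ D).filter (fun dd => dd.1 - dd.2 = g)).card : ℤ) = klm.2.1)) ∧
  (∀ g ∉ D, g ≠ (0 : G) →
    ((((D ×ˢ D).filter (fun dd => dd.1 - dd.2 = g)).card : ℤ) = klm.2.2))

/-- Parameter set (35) for `|I| = cI` and `ε`. -/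
def param35 (p n s : ℕ) (ε cI : ℤ) : ℤ × ℤ × ℤ :=
  ((p : ℤ) ^ (n - s) * cI + ε * (p : ℤ) ^ (n / 2 - s) * ((p : ℤ) ^ s - cI) - 1,
   (p : ℤ) ^ (n - 2 * s) * cI ^ 2 + ε * (p : ℤ) ^ (n / 2 - s) * ((p : ℤ) ^ s - cI) - 2,
   (p : ℤ) ^ (n - 2 * s) * cI ^ 2 + ε * (p : ℤ) ^ (n / 2 - s) * cI)

/-- Parameter set (36) for `|I| = cI` and `ε`. -/
def param36 (p n s : ℕ) (ε cI : ℤ) : ℤ × ℤ × ℤ :=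
  ((p : ℤ) ^ (n - s) * cI - ε * (p : ℤ) ^ (n / 2 - s) * cI,
   (p : ℤ) ^ (n - 2 * s) * cI ^ 2 + ε * (p : ℤ) ^ (n / 2 - s) * ((p : ℤ) ^ s - 3 * cI),
   (p : ℤ) ^ (n - 2 * s) * cI ^ 2 - ε * (p : ℤ) ^ (n / 2 - s) * cI)

section CharacterSums

variable {p n : ℕ} [Fact p.Prime]

lemma zetaP_eq_stdAddChar (t : ZMod p) : zetaP p t = ZMod.stdAddChar t := by
  rw [ZMod.stdAddChar_apply, ZMod.toCircle_apply, zetaP]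

lemma zetaP_add (s t : ZMod p) : zetaP p (s + t) = zetaP p s * zetaP p t := by
  simp only [zetaP_eq_stdAddChar, AddChar.map_add_eq_mul]

lemma zetaP_zero : zetaP p 0 = 1 := by
  simp only [zetaP_eq_stdAddChar, AddChar.map_zero_eq_one]

lemma conj_zetaP (t : ZMod p) : (starRingEnd ℂ) (zetaP p t) = zetaP p (-t) := by
  simp only [zetaP_eq_stdAddChar, AddChar.map_neg_eq_conj]

lemma ip_comm (a x : Fin n → ZMod p) : ip a x = ip x a := dotProduct_comm a x

lemma ip_add (a x y : Fin n → ZMod p) : ip a (x + y) = ip a x + ip a y := dotProduct_add a x y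

lemma ip_sub (a x y : Fin n → ZMod p) : ip a (x - y) = ip a x - ip a y := dotProduct_sub a x y

lemma ip_neg (a x : Fin n → ZMod p) : ip a (-x) = -ip a x := dotProduct_neg a x

lemma ip_zero (a : Fin n → ZMod p) : ip a 0 = 0 := dotProduct_zero a

lemma zero_ip (a : Fin n → ZMod p) : ip 0 a = 0 := zero_dotProduct a

/-- Orthogonality of the characters of `V_n`. -/
lemma sum_zetaP_ip (x : Fin n → ZMod p) :
    ∑ a : Fin n → ZMod p, zetaP p (ip a x) = if x = 0 then (p : ℂ) ^ n else 0 := by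
  classical
  let ψ : AddChar (Fin n → ZMod p) ℂ :=
    { toFun := fun a => zetaP p (ip a x)
      map_zero_eq_one' := by rw [zero_ip, zetaP_zero]
      map_add_eq_mul' := fun a b => by
        rw [ip_comm, ip_add, zetaP_add, ip_comm x a, ip_comm x b] }
  have hψ : ψ = 0 ↔ x = 0 := by
    constructor
    · intro h
      funext i
      have h1 : zetaP p (ip (Pi.single i 1) x) = 1 := by
        change ψ (Pi.single i 1) = 1
        rw [h, AddChar.zero_apply]
      have h2 : ip (Pi.single i 1) x = x i := by
        change (Pi.single i 1 : Fin n → ZMod p) ⬝ᵥ x = x i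
        rw [single_one_dotProduct]
      rw [h2, ← zetaP_zero (p := p), zetaP_eq_stdAddChar, zetaP_eq_stdAddChar] at h1
      exact ZMod.injective_stdAddChar h1
    · rintro rfl
      ext a
      change zetaP p (ip a 0) = _
      rw [ip_zero, zetaP_zero, AddChar.zero_apply]
  have h := AddChar.sum_eq_ite ψ
  simp only [hψ, Fintype.card_pi, ZMod.card, prod_const, card_univ, Fintype.card_fin,
    Nat.cast_pow] at h
  exact h

/-- The character sum of `E` at `a`. -/
noncomputable def charSum (E : Finset (Fin n → ZMod p)) (a : Fin n → ZMod p) : ℂ :=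
  ∑ x ∈ E, zetaP p (-ip a x)

/-- The number of representations of `g` as a difference of elements of `E`. -/
def diffCount {G : Type*} [AddCommGroup G] [DecidableEq G] (E : Finset G) (g : G) : ℕ :=
  ((E ×ˢ E).filter (fun dd => dd.1 - dd.2 = g)).card

lemma charSum_zero (E : Finset (Fin n → ZMod p)) : charSum E 0 = E.card := by
  simp [charSum, zero_ip, zetaP_zero]

lemma sum_charSum_mul_zetaP (E : Finset (Fin n → ZMod p)) (g : Fin n → ZMod p) :
    ∑ a, charSum E a * zetaP p (ip a g) = (p : ℂ) ^ n * if g ∈ E then 1 else 0 := by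
  simp only [charSum, sum_mul, ← zetaP_add]
  rw [sum_comm]
  have h : ∀ x a : Fin n → ZMod p, -ip a x + ip a g = ip a (g - x) := fun x a => by
    rw [ip_sub]; ring
  simp only [h, sum_zetaP_ip, sub_eq_zero]
  simp

lemma charSum_eq_sum_neg {E : Finset (Fin n → ZMod p)} (hE : ∀ x, -x ∈ E ↔ x ∈ E)
    (a : Fin n → ZMod p) : charSum E a = ∑ x ∈ E, zetaP p (ip a x) := by
  refine sum_bij' (fun x _ => -x) (fun x _ => -x) ?_ ?_ ?_ ?_ ?_
  · exact fun x hx => (hE x).2 hx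
  · exact fun x hx => (hE x).2 hx
  · simp
  · simp
  · intro x _
    rw [ip_neg]

lemma charSum_sq {E : Finset (Fin n → ZMod p)} (hE : ∀ x, -x ∈ E ↔ x ∈ E)
    (a : Fin n → ZMod p) :
    charSum E a ^ 2 = ∑ g, (diffCount E g : ℂ) * zetaP p (-ip a g) := by
  have h1 : charSum E a ^ 2 = ∑ d ∈ E ×ˢ E, zetaP p (-ip a (d.1 - d.2)) := by
    rw [sq]
    nth_rewrite 2 [charSum_eq_sum_neg hE]
    rw [charSum, sum_mul_sum, sum_product]
    refine sum_congr rfl fun x _ => sum_congr rfl fun y _ => ?_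
    rw [← zetaP_add, ip_sub]
    congr 1
    ring
  rw [h1, ← sum_fiberwise (E ×ˢ E) (fun d => d.1 - d.2)]
  refine sum_congr rfl fun g _ => ?_
  rw [diffCount, ← nsmul_eq_mul]
  refine sum_eq_card_nsmul fun d hd => ?_
  rw [(mem_filter.1 hd).2]

lemma sum_charSum_sq_mul_zetaP {E : Finset (Fin n → ZMod p)} (hE : ∀ x, -x ∈ E ↔ x ∈ E)
    (g : Fin n → ZMod p) :
    ∑ a, charSum E a ^ 2 * zetaP p (ip a g) = (p : ℂ) ^ n * diffCount E g := by
  simp only [charSum_sq hE, sum_mul, mul_assoc, ← zetaP_add]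
  rw [sum_comm]
  have h : ∀ x a : Fin n → ZMod p, -ip a x + ip a g = ip a (g - x) := fun x a => by
    rw [ip_sub]; ring
  simp only [h, ← mul_sum, sum_zetaP_ip, sub_eq_zero]
  simp [mul_comm]

lemma neg_mem_iff_of_conj_charSum {E : Finset (Fin n → ZMod p)}
    (hE : ∀ a, (starRingEnd ℂ) (charSum E a) = charSum E a) (x : Fin n → ZMod p) :
    -x ∈ E ↔ x ∈ E := by
  have h1 := sum_charSum_mul_zetaP E x
  have h2 := sum_charSum_mul_zetaP E (-x)
  apply_fun (starRingEnd ℂ) at h1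
  simp only [map_sum, map_mul, hE, conj_zetaP, ← ip_neg] at h1
  rw [h2] at h1
  have hp : (p : ℂ) ^ n ≠ 0 := pow_ne_zero _ (Nat.cast_ne_zero.2 (Fact.out : p.Prime).ne_zero)
  simp only [map_pow, map_natCast, apply_ite (starRingEnd ℂ), map_one, map_zero] at h1
  have h3 := mul_left_cancel₀ hp h1
  by_cases hx : x ∈ E <;> by_cases hx' : -x ∈ E <;> simp_all

end CharacterSums

section Differences

lemma diffCount_zero {G : Type*} [AddCommGroup G] [DecidableEq G] (E : Finset G) :
    diffCount E 0 = E.card := by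
  have h : (E ×ˢ E).filter (fun dd => dd.1 - dd.2 = 0) = E.diag := by
    ext d
    simp only [mem_filter, mem_product, mem_diag, sub_eq_zero]
    constructor
    · rintro ⟨⟨h1, _⟩, h3⟩
      exact ⟨h1, h3⟩
    · rintro ⟨h1, h3⟩
      exact ⟨⟨h1, h3 ▸ h1⟩, h3⟩
  rw [diffCount, h, diag_card]

lemma diffCount_erase_zero_add {G : Type*} [AddCommGroup G] [DecidableEq G] {E : Finset G}
    (hE : ∀ x, -x ∈ E ↔ x ∈ E) (h0 : 0 ∈ E) {g : G} (hg : g ≠ 0) :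
    diffCount (E.erase 0) g + (if g ∈ E then 2 else 0) = diffCount E g := by
  have hset : (E ×ˢ E).filter (fun dd => dd.1 - dd.2 = g) =
      ((E.erase 0 ×ˢ E.erase 0).filter (fun dd => dd.1 - dd.2 = g)) ∪
        (if g ∈ E then {(g, 0), (0, -g)} else ∅) := by
    ext ⟨x, y⟩
    by_cases hgE : g ∈ E
    · have := (hE g).2 hgE
      simp only [mem_filter, mem_product, mem_union, mem_erase, if_pos hgE, mem_insert,
        mem_singleton, Prod.mk.injEq]
      constructor
      · rintro ⟨⟨hx, hy⟩, rfl⟩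
        by_cases hx0 : x = 0
        · subst hx0
          simp
        · by_cases hy0 : y = 0
          · subst hy0
            simp
          · exact Or.inl ⟨⟨⟨hx0, hx⟩, hy0, hy⟩, rfl⟩
      · rintro (⟨⟨⟨_, hx⟩, _, hy⟩, h⟩ | ⟨rfl, rfl⟩ | ⟨rfl, rfl⟩)
        · exact ⟨⟨hx, hy⟩, h⟩
        · exact ⟨⟨hgE, h0⟩, sub_zero _⟩
        · exact ⟨⟨h0, this⟩, by simp⟩
    · simp only [mem_filter, mem_product, mem_union, mem_erase, if_neg hgE, notMem_empty, or_false]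
      constructor
      · rintro ⟨⟨hx, hy⟩, rfl⟩
        refine ⟨⟨⟨?_, hx⟩, ?_, hy⟩, rfl⟩
        · rintro rfl
          exact hgE ((hE _).1 (by simpa using hy))
        · rintro rfl
          exact hgE (by simpa using hx)
      · rintro ⟨⟨⟨_, hx⟩, _, hy⟩, h⟩
        exact ⟨⟨hx, hy⟩, h⟩
  rw [diffCount, diffCount, hset, card_union_of_disjoint]
  · congr 1
    split_ifs
    · rw [card_pair]
      simp [hg]
    · simp
  · split_ifs
    · simp only [disjoint_insert_right, disjoint_singleton_right, mem_filter, mem_product,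
        mem_erase]
      simp
    · simp

/-- The partial difference set property of `E \ {0}` in terms of the difference counts of `E`. -/
lemma isPDS_erase_zero_iff {G : Type*} [AddCommGroup G] [Fintype G] [DecidableEq G]
    {E : Finset G} (hE : ∀ x, -x ∈ E ↔ x ∈ E) (v k l m : ℤ) :
    IsPDS (E.erase 0) v (k, l, m) ↔
      (Fintype.card G : ℤ) = v ∧ (E.card : ℤ) = k + (if 0 ∈ E then 1 else 0) ∧
      ∀ g ≠ 0, (diffCount E g : ℤ) = if g ∈ E then l + (if 0 ∈ E then 2 else 0) else m := by
  have hN : ∀ g ≠ 0, (diffCount E g : ℤ) =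
      diffCount (E.erase 0) g + if g ∈ E then (if 0 ∈ E then 2 else 0) else 0 := by
    intro g hg
    by_cases h0 : 0 ∈ E
    · rw [← diffCount_erase_zero_add hE h0 hg]
      split_ifs <;> simp
    · rw [erase_eq_of_notMem h0]
      simp [h0]
  have hc : (E.card : ℤ) = (E.erase 0).card + if 0 ∈ E then 1 else 0 := by
    by_cases h0 : 0 ∈ E
    · rw [← card_erase_add_one h0]
      simp [h0]
    · simp [h0]
  unfold IsPDS
  refine and_congr Iff.rfl (and_congr (by rw [hc]; simp) ?_)
  constructor
  · rintro ⟨h1, h2⟩ g hg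
    rw [hN g hg]
    by_cases hgE : g ∈ E
    · rw [if_pos hgE, if_pos hgE]
      exact congrArg (· + _) (h1 g (mem_erase.2 ⟨hg, hgE⟩) hg)
    · rw [if_neg hgE, if_neg hgE, add_zero]
      exact h2 g (fun h => hgE (mem_of_mem_erase h)) hg
  · intro h
    refine ⟨fun g hgE hg => ?_, fun g hgE hg => ?_⟩
    · have hgE' := mem_of_mem_erase hgE
      have := h g hg
      rw [hN g hg, if_pos hgE', if_pos hgE'] at this
      exact add_right_cancel this
    · have hgE' : g ∉ E := fun h => hgE (mem_erase.2 ⟨hg, h⟩)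
      have := h g hg
      rwa [hN g hg, if_neg hgE', if_neg hgE', add_zero] at this

end Differences

section PartialDifferenceSets

variable {p n s : ℕ} [Fact p.Prime]

/-- Both parameter sets at once, in terms of the size and the difference counts of `E`. -/
lemma isPDS_params_iff (hneven : Even n) (hsn : s ≤ n / 2) {E : Finset (Fin n → ZMod p)}
    (hE : ∀ x, -x ∈ E ↔ x ∈ E) (ε c : ℤ) :
    ((0 ∈ E → IsPDS (E.erase 0) ((p : ℤ) ^ n) (param35 p n s ε c)) ∧
      (0 ∉ E → IsPDS (E.erase 0) ((p : ℤ) ^ n) (param36 p n s ε c))) ↔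
    (E.card : ℤ) = ((p : ℤ) ^ (n / 2 - s)) ^ 2 * (p : ℤ) ^ s * c +
        ε * (p : ℤ) ^ (n / 2 - s) * ((p : ℤ) ^ s * (if 0 ∈ E then 1 else 0) - c) ∧
      ∀ g ≠ 0, (diffCount E g : ℤ) =
        ε * (p : ℤ) ^ (n / 2 - s) * ((p : ℤ) ^ s - 2 * c) * (if g ∈ E then 1 else 0) +
        (((p : ℤ) ^ (n / 2 - s)) ^ 2 * c ^ 2 +
          (2 * (if 0 ∈ E then 1 else 0) - 1) * ε * (p : ℤ) ^ (n / 2 - s) * c) := by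
  obtain ⟨m, rfl⟩ := hneven
  have hm : (m + m) / 2 = m := by omega
  rw [hm] at hsn ⊢
  obtain ⟨r, rfl⟩ := Nat.exists_eq_add_of_le hsn
  have e1 : s + r - s = r := by omega
  have e2 : s + r + (s + r) - s = r * 2 + s := by omega
  have e3 : s + r + (s + r) - 2 * s = r * 2 := by omega
  have hcard : (Fintype.card (Fin (s + r + (s + r)) → ZMod p) : ℤ) =
      (p : ℤ) ^ (s + r + (s + r)) := by
    simp [Fintype.card_pi, ZMod.card]
  simp only [param35, param36, isPDS_erase_zero_iff hE, hm, e1, e2, e3, hcard, true_and, pow_add,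
    pow_mul]
  by_cases h0 : 0 ∈ E
  · simp only [h0, true_imp_iff, not_true, false_imp_iff, and_true, if_true]
    refine and_congr (by constructor <;> intro h <;> linarith) ?_
    refine forall₂_congr fun g _ => ?_
    split_ifs <;> constructor <;> intro h <;> linarith
  · simp only [h0, true_imp_iff, not_false_eq_true, false_imp_iff, true_and, if_false]
    refine and_congr (by constructor <;> intro h <;> linarith) ?_
    refine forall₂_congr fun g _ => ?_
    split_ifs <;> constructor <;> intro h <;> linarith

/-- A set whose nontrivial character sums take two values has two difference counts. -/
lemma diffCount_of_charSum {E : Finset (Fin n → ZMod p)} (hE : ∀ x, -x ∈ E ↔ x ∈ E)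
    {P : (Fin n → ZMod p) → Prop} [DecidablePred P] {ε u Q c : ℂ} (hε : ε ^ 2 = 1)
    (hp : (p : ℂ) ^ n = u ^ 2 * Q ^ 2)
    (hT : ∀ a, charSum E a = u ^ 2 * Q * c * (if a = 0 then 1 else 0) +
      ε * u * (Q * (if P a then 1 else 0) - c)) (g : Fin n → ZMod p) :
    (diffCount E g : ℂ) = ε * u * (Q - 2 * c) * (if g ∈ E then 1 else 0) +
      u ^ 2 * c * (Q - c) * (if g = 0 then 1 else 0) +
      (u ^ 2 * c ^ 2 + (2 * (if P 0 then 1 else 0) - 1) * ε * u * c) := by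
  have hp0 : (p : ℂ) ^ n ≠ 0 := pow_ne_zero _ (Nat.cast_ne_zero.2 (Fact.out : p.Prime).ne_zero)
  have hpt : ∀ a, charSum E a ^ 2 * zetaP p (ip a g) =
      ε * u * (Q - 2 * c) * (charSum E a * zetaP p (ip a g)) +
      u ^ 2 * c * (Q - c) * zetaP p (ip a g) +
      (if a = 0 then (p : ℂ) ^ n * (u ^ 2 * c ^ 2 +
        (2 * (if P 0 then 1 else 0) - 1) * ε * u * c) else 0) := by
    intro a
    rw [hT a, hp]
    by_cases ha : a = 0
    · subst ha
      simp only [if_true, zero_ip, zetaP_zero]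
      split_ifs
      · linear_combination (u^2*(Q-c)*c) * hε
      · linear_combination (u^2*(Q-c)*c) * hε
    · simp only [if_neg ha]
      split_ifs
      · linear_combination (u^2*(Q-c)*c * zetaP p (ip a g)) * hε
      · linear_combination (u^2*(Q-c)*c * zetaP p (ip a g)) * hε
  have h := sum_charSum_sq_mul_zetaP hE g
  simp only [hpt, sum_add_distrib, ← mul_sum, sum_charSum_mul_zetaP, sum_zetaP_ip,
    sum_ite_eq', mem_univ, if_true] at h
  apply mul_left_cancel₀ hp0
  rw [← h]
  split_ifs <;> ring

/-- The value condition at `0` is forced by counting elements of `E`. -/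
lemma ite_eq_of_charSum {E : Finset (Fin n → ZMod p)} (hE : ∀ x, -x ∈ E ↔ x ∈ E)
    {P : (Fin n → ZMod p) → Prop} [DecidablePred P] {ε u Q c : ℂ} (hε : ε ^ 2 = 1)
    (hp : (p : ℂ) ^ n = u ^ 2 * Q ^ 2) (hu : u ≠ 0) (hQ : Q - 2 * c ≠ 0)
    (hT : ∀ a, charSum E a = u ^ 2 * Q * c * (if a = 0 then 1 else 0) +
      ε * u * (Q * (if P a then 1 else 0) - c)) : P 0 ↔ 0 ∈ E := by
  have h1 := diffCount_of_charSum hE hε hp hT 0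
  rw [diffCount_zero, ← charSum_zero, hT 0] at h1
  have hε0 : ε ≠ 0 := by
    rintro rfl
    norm_num at hε
  have key : (ε * u * (Q - 2 * c)) * ((if P 0 then 1 else 0) - (if 0 ∈ E then 1 else 0)) = 0 := by
    simp only [if_true] at h1
    linear_combination h1
  have h2 := (mul_eq_zero.1 key).resolve_left (mul_ne_zero (mul_ne_zero hε0 hu) hQ)
  by_cases hP : P 0 <;> by_cases h0 : 0 ∈ E <;> simp_all

/-- A symmetric set with two difference counts has two nontrivial character values. -/
lemma charSum_of_diffCount {E : Finset (Fin n → ZMod p)} (hE : ∀ x, -x ∈ E ↔ x ∈ E)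
    {ε u Q c : ℂ} (hε : ε ^ 2 = 1)
    (hcard : (E.card : ℂ) = u ^ 2 * Q * c + ε * u * (Q * (if 0 ∈ E then 1 else 0) - c))
    (hN : ∀ g ≠ 0, (diffCount E g : ℂ) = ε * u * (Q - 2 * c) * (if g ∈ E then 1 else 0) +
      (u ^ 2 * c ^ 2 + (2 * (if 0 ∈ E then 1 else 0) - 1) * ε * u * c))
    {a : Fin n → ZMod p} (ha : a ≠ 0) :
    charSum E a = ε * u * (Q - c) ∨ charSum E a = ε * u * (0 - c) := by
  have hN' : ∀ g, (diffCount E g : ℂ) * zetaP p (-ip a g) =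
      ε * u * (Q - 2 * c) * (if g ∈ E then zetaP p (-ip a g) else 0) +
      (if g = 0 then u ^ 2 * c * (Q - c) else 0) +
      (u ^ 2 * c ^ 2 + (2 * (if 0 ∈ E then 1 else 0) - 1) * ε * u * c) *
        zetaP p (ip g (-a)) := by
    intro g
    rw [ip_neg, ip_comm g a]
    by_cases hg : g = 0
    · subst hg
      rw [diffCount_zero, hcard, ip_zero, neg_zero, zetaP_zero]
      simp only [if_true]
      split_ifs <;> ring
    · rw [hN g hg]
      simp only [if_neg hg]
      split_ifs <;> ring
  have h := charSum_sq hE a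
  simp only [hN', sum_add_distrib, ← mul_sum, sum_zetaP_ip, neg_eq_zero, if_neg ha, sum_ite_eq',
    mem_univ, if_true, sum_ite_mem, univ_inter] at h
  rw [← charSum] at h
  have h2 : (charSum E a - ε * u * (Q - c)) * (charSum E a - ε * u * (0 - c)) = 0 := by
    linear_combination h - u ^ 2 * c * (Q - c) * hε
  rcases mul_eq_zero.1 h2 with h3 | h3
  · exact Or.inl (sub_eq_zero.1 h3)
  · exact Or.inr (sub_eq_zero.1 h3)

/-- Character sums of preimages in terms of the Walsh transforms of the components. -/
lemma pow_mul_charSum_preimage (F : (Fin n → ZMod p) → (Fin s → ZMod p))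
    (I : Finset (Fin s → ZMod p)) (a : Fin n → ZMod p) :
    (p : ℂ) ^ s * charSum (univ.filter fun x => F x ∈ I) a =
      ∑ i ∈ I, ∑ c, walsh (fun x => ip c (F x)) a * zetaP p (-ip c i) := by
  have h : ∀ i c x, zetaP p (ip c (F x) - ip a x) * zetaP p (-ip c i) =
      zetaP p (-ip a x) * zetaP p (ip c (F x - i)) := by
    intro i c x
    rw [← zetaP_add, ← zetaP_add, ip_sub]
    congr 1
    ring
  simp only [walsh, sum_mul, h]
  have h2 : ∀ i, ∑ c : Fin s → ZMod p, ∑ x, zetaP p (-ip a x) * zetaP p (ip c (F x - i)) =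
      ∑ x, zetaP p (-ip a x) * if F x = i then (p : ℂ) ^ s else 0 := by
    intro i
    rw [sum_comm]
    simp only [← mul_sum, sum_zetaP_ip, sub_eq_zero]
  simp only [h2]
  rw [sum_comm, charSum, sum_filter, mul_sum]
  refine sum_congr rfl fun x _ => ?_
  rw [← mul_sum, sum_ite_eq]
  split_ifs <;> ring

lemma walsh_eq_sum_charSum (F : (Fin n → ZMod p) → (Fin s → ZMod p))
    (c : Fin s → ZMod p) (a : Fin n → ZMod p) :
    walsh (fun x => ip c (F x)) a =
      ∑ i, zetaP p (ip c i) * charSum (univ.filter fun x => F x ∈ ({i} : Finset _)) a := by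
  rw [walsh, ← sum_fiberwise univ F]
  refine sum_congr rfl fun i _ => ?_
  simp only [mem_singleton]
  rw [charSum, mul_sum]
  refine sum_congr rfl fun x hx => ?_
  rw [(mem_filter.1 hx).2, ← zetaP_add, sub_eq_add_neg]

lemma sum_charSum_fibers (F : (Fin n → ZMod p) → (Fin s → ZMod p)) {a : Fin n → ZMod p}
    (ha : a ≠ 0) :
    ∑ i, charSum (univ.filter fun x => F x ∈ ({i} : Finset _)) a = 0 := by
  have h := walsh_eq_sum_charSum F 0 a
  simp only [zero_ip, zetaP_zero, one_mul] at h
  rw [← h, walsh]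
  have h2 : ∀ x, zetaP p (0 - ip a x) = zetaP p (ip x (-a)) := fun x => by
    rw [ip_neg, ip_comm, zero_sub]
  simp only [h2, sum_zetaP_ip, neg_eq_zero, if_neg ha]

/-- The character sums of preimages under a function satisfying Condition A. -/
lemma charSum_preimage_of_walsh {F Fd : (Fin n → ZMod p) → (Fin s → ZMod p)} {ε u Q : ℂ}
    (hQ : (p : ℂ) ^ s = Q) (hQ0 : Q ≠ 0) (hm : (p : ℂ) ^ (n / 2) = u * Q)
    (hp : (p : ℂ) ^ n = u ^ 2 * Q ^ 2)
    (hW : ∀ c, c ≠ 0 → ∀ a, walsh (fun x => ip c (F x)) a =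
      ε * (p : ℂ) ^ (n / 2) * zetaP p (ip c (Fd a)))
    (I : Finset (Fin s → ZMod p)) (a : Fin n → ZMod p) :
    charSum (univ.filter fun x => F x ∈ I) a =
      u ^ 2 * Q * I.card * (if a = 0 then 1 else 0) +
        ε * u * (Q * (if Fd a ∈ I then 1 else 0) - I.card) := by
  have h := pow_mul_charSum_preimage F I a
  have hw0 : walsh (fun x => ip (0 : Fin s → ZMod p) (F x)) a =
      u ^ 2 * Q ^ 2 * (if a = 0 then 1 else 0) := by
    simp only [walsh, zero_ip]
    have h2 : ∀ x, zetaP p (0 - ip a x) = zetaP p (ip x (-a)) := fun x => by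
      rw [ip_neg, ip_comm, zero_sub]
    simp only [h2, sum_zetaP_ip, neg_eq_zero, hp, mul_ite, mul_one, mul_zero]
  have hin : ∀ i c, walsh (fun x => ip c (F x)) a * zetaP p (-ip c i) =
      ε * (u * Q) * zetaP p (ip c (Fd a - i)) +
        if c = 0 then u ^ 2 * Q ^ 2 * (if a = 0 then 1 else 0) - ε * (u * Q) else 0 := by
    intro i c
    by_cases hc : c = 0
    · subst hc
      rw [hw0, zero_ip, zero_ip, neg_zero, zetaP_zero, if_pos rfl]
      ring
    · rw [hW c hc, if_neg hc, ip_sub, sub_eq_add_neg, zetaP_add, hm]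
      ring
  simp only [hin, sum_add_distrib, ← mul_sum, sum_zetaP_ip, sum_ite_eq', mem_univ, if_true,
    sub_eq_zero, sum_ite_eq, sum_const, nsmul_eq_mul, hQ] at h
  apply mul_left_cancel₀ hQ0
  rw [h]
  split_ifs <;> ring

end PartialDifferenceSets

theorem stmt13 (p : ℕ) [Fact p.Prime] (n s : ℕ) (hn : 0 < n) (hneven : Even n)
    (hs : 0 < s) (hsn : s ≤ n / 2) (hps : Odd p ∨ 2 ≤ s)
    (ε : ℤ) (hε : ε = 1 ∨ ε = -1) (hε2 : p = 2 → ε = 1)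
    (F : (Fin n → ZMod p) → (Fin s → ZMod p)) :
    ConditionA p F ε ↔
      ∀ I : Finset (Fin s → ZMod p), I.Nonempty →
        (∀ x : Fin n → ZMod p, F (-x) ∈ I ↔ F x ∈ I) ∧
        (F 0 ∈ I →
          IsPDS ((Finset.univ.filter (fun x => F x ∈ I)).erase 0)
            ((p : ℤ) ^ n) (param35 p n s ε I.card)) ∧
        (F 0 ∉ I →
          IsPDS ((Finset.univ.filter (fun x => F x ∈ I)).erase 0)
            ((p : ℤ) ^ n) (param36 p n s ε I.card)) := by
  have hp0 : (p : ℂ) ≠ 0 := Nat.cast_ne_zero.2 (Fact.out : p.Prime).ne_zero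
  have hm : (p : ℂ) ^ (n / 2) = (p : ℂ) ^ (n / 2 - s) * (p : ℂ) ^ s := by
    rw [← pow_add, Nat.sub_add_cancel hsn]
  have hpn : (p : ℂ) ^ n = ((p : ℂ) ^ (n / 2 - s)) ^ 2 * ((p : ℂ) ^ s) ^ 2 := by
    rw [← mul_pow, ← hm, ← pow_mul, Nat.div_mul_cancel hneven.two_dvd]
  have hεC : (ε : ℂ) ^ 2 = 1 := by rcases hε with rfl | rfl <;> norm_num
  have hu0 : (p : ℂ) ^ (n / 2 - s) ≠ 0 := pow_ne_zero _ hp0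
  have hQ0 : (p : ℂ) ^ s ≠ 0 := pow_ne_zero _ hp0
  constructor
  · rintro ⟨Fd, hFd⟩ I -
    have hT := charSum_preimage_of_walsh rfl hQ0 hm hpn hFd
    have hsym : ∀ (J : Finset (Fin s → ZMod p)) (x : Fin n → ZMod p),
        -x ∈ univ.filter (fun x => F x ∈ J) ↔ x ∈ univ.filter (fun x => F x ∈ J) := by
      intro J
      apply neg_mem_iff_of_conj_charSum
      intro a
      rw [hT]
      split_ifs <;> simp
    have hQ2 : (p : ℂ) ^ s - 2 * (({F 0} : Finset (Fin s → ZMod p)).card : ℂ) ≠ 0 := by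
      rw [card_singleton, Nat.cast_one, mul_one, sub_ne_zero]
      have h2 : p ^ s ≠ 2 := by
        intro h
        have hs1 : s = 1 := by
          by_contra hne
          exact Nat.Prime.not_prime_pow (by omega : 2 ≤ s) (h ▸ Nat.prime_two)
        subst hs1
        rw [pow_one] at h
        subst h
        rcases hps with h | h
        · exact absurd h (by decide)
        · omega
      exact_mod_cast h2
    have hF0 : Fd 0 = F 0 := by
      have := ite_eq_of_charSum (P := fun a => Fd a ∈ ({F 0} : Finset _)) (hsym {F 0}) hεC hpn hu0
        hQ2 (hT {F 0})
      simpa using this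
    have hmem : (0 : Fin n → ZMod p) ∈ univ.filter (fun x => F x ∈ I) ↔ F 0 ∈ I := by simp
    refine ⟨fun x => by simpa using hsym I x, ?_⟩
    have key := (isPDS_params_iff (s := s) hneven hsn (hsym I) ε I.card).2 ?_
    · simpa only [hmem] using key
    constructor
    · have h := hT I 0
      rw [charSum_zero, if_pos rfl, mul_one, hF0] at h
      simp only [hmem]
      exact_mod_cast h
    · intro g hg
      have h := diffCount_of_charSum (P := fun a => Fd a ∈ I) (hsym I) hεC hpn (hT I) g
      simp only [if_neg hg, hF0, mul_zero, add_zero] at h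
      simp only [hmem]
      exact_mod_cast h
  · intro H
    set u : ℂ := (p : ℂ) ^ (n / 2 - s) with hu
    set Q : ℂ := (p : ℂ) ^ s with hQ
    have hε0 : (ε : ℂ) ≠ 0 := by
      intro h
      norm_num [h] at hεC
    have hsym : ∀ (i : Fin s → ZMod p) (x : Fin n → ZMod p),
        -x ∈ univ.filter (fun x => F x ∈ ({i} : Finset _)) ↔
          x ∈ univ.filter (fun x => F x ∈ ({i} : Finset _)) := fun i x => by
      simpa using (H {i} (singleton_nonempty i)).1 x
    have hmem : ∀ i, (0 : Fin n → ZMod p) ∈ univ.filter (fun x => F x ∈ ({i} : Finset _)) ↔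
        F 0 ∈ ({i} : Finset _) := by simp
    have hpar := fun i => (isPDS_params_iff (s := s) hneven hsn (hsym i) ε
      ({i} : Finset (Fin s → ZMod p)).card).1 (by
        simp only [hmem]
        exact (H {i} (singleton_nonempty i)).2)
    simp only [card_singleton, Nat.cast_one, mul_one, one_pow] at hpar
    have hcard : ∀ i, ((univ.filter (fun x => F x ∈ ({i} : Finset _))).card : ℂ) =
        u ^ 2 * Q * 1 + ε * u * (Q * (if F 0 = i then 1 else 0) - 1) := by
      intro i
      have h := congrArg (Int.cast : ℤ → ℂ) (hpar i).1
      simp only [hmem] at h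
      push_cast at h
      rw [h, mul_one]
      simp only [mem_singleton, hu, hQ]
    have hval : ∀ a, a ≠ 0 → ∀ i,
        charSum (univ.filter fun x => F x ∈ ({i} : Finset _)) a = ε * u * (Q - 1) ∨
        charSum (univ.filter fun x => F x ∈ ({i} : Finset _)) a = ε * u * (0 - 1) := by
      intro a ha i
      refine charSum_of_diffCount (hsym i) hεC ?_ ?_ ha
      · rw [hcard i]
        simp only [hmem]
        simp only [mem_singleton]
      · intro g hg
        have h := congrArg (Int.cast : ℤ → ℂ) ((hpar i).2 g hg)
        push_cast at h
        rw [mul_one, one_pow, mul_one, mul_one]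
        exact h
    have hex : ∀ a, ∃ j, ∀ i, charSum (univ.filter fun x => F x ∈ ({i} : Finset _)) a =
        u ^ 2 * Q * (if a = 0 then 1 else 0) + ε * u * (Q * (if j = i then 1 else 0) - 1) := by
      intro a
      by_cases ha : a = 0
      · subst ha
        refine ⟨F 0, fun i => ?_⟩
        rw [charSum_zero, hcard i, if_pos rfl]
      · classical
        simp only [if_neg ha, mul_zero, zero_add]
        set S := univ.filter fun i =>
          charSum (univ.filter fun x => F x ∈ ({i} : Finset _)) a = ε * u * (Q - 1) with hS
        have hvS : ∀ i, charSum (univ.filter fun x => F x ∈ ({i} : Finset _)) a =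
            ε * u * (Q * (if i ∈ S then 1 else 0) - 1) := by
          intro i
          by_cases hi : i ∈ S
          · rw [if_pos hi, mul_one]
            exact (mem_filter.1 hi).2
          · rw [if_neg hi, mul_zero]
            exact (hval a ha i).resolve_left fun h => hi (mem_filter.2 ⟨mem_univ _, h⟩)
        have hsum := sum_charSum_fibers F ha
        simp only [hvS, ← mul_sum, sum_sub_distrib, sum_ite_mem, univ_inter, sum_const,
          card_univ, Fintype.card_pi, ZMod.card, prod_const, Fintype.card_fin, nsmul_eq_mul,
          mul_one, Nat.cast_pow, ← hQ] at hsum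
        have hc : (S.card : ℂ) = 1 := by
          have h := (mul_eq_zero.1 hsum).resolve_left (mul_ne_zero hε0 hu0)
          apply mul_left_cancel₀ hQ0
          linear_combination h
        obtain ⟨j, hj⟩ := card_eq_one.1 (by exact_mod_cast hc : S.card = 1)
        refine ⟨j, fun i => ?_⟩
        rw [hvS i, hj]
        simp only [mem_singleton, eq_comm]
    choose Fd hFd using hex
    refine ⟨Fd, fun c hc a => ?_⟩
    rw [walsh_eq_sum_charSum, hm]
    have hterm : ∀ i, zetaP p (ip c i) *
        charSum (univ.filter fun x => F x ∈ ({i} : Finset _)) a =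
        (u ^ 2 * Q * (if a = 0 then 1 else 0) - ε * u) * zetaP p (ip i c) +
          if Fd a = i then ε * (u * Q) * zetaP p (ip c i) else 0 := by
      intro i
      rw [hFd a i, ip_comm i c]
      split_ifs <;> ring
    simp only [hterm, sum_add_distrib, ← mul_sum, sum_zetaP_ip, if_neg hc, mul_zero, zero_add,
      sum_ite_eq, mem_univ, if_true]
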